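/- Fix integers v₁ and v₂. For every list L : List Bool and every x : ℤ, the left fold over L of the map sending state y and Boolean b to (if b then v₁·y else v₂·y), starting at x, equals v₁^(L.count true) · v₂^(L.count false) · x. That is, the geometric-progression updates y ↦ v₁·y and y ↦ v₂·y merge to the function i(κ_c, κ_d) = α_i · v₁^{κ_c} · v₂^{κ_d} of the chain counters. -/

import Mathlib

theorem stmt12 (v₁ v₂ : ℤ) (L : List Bool) (x : ℤ) :
    L.foldl (fun y b => if b then v₁ * y else v₂ * y) x =
      v₁ ^ (L.count true) * v₂ ^ (L.count false) * x := by
  induction L generalizing x with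
  | nil => simp
  | cons b L ih =>
    rw [List.foldl_cons, ih]
    cases b <;> simp [pow_succ] <;> ring
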